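/- arXiv:2207.06380 — 3 statements merged into one kernel-verified Lean document; each statement's English description precedes it below -/
import Mathlib

section
/- Let 𝕜 be an algebraically closed field of characteristic p > 0, R = 𝕜[x_1,…,x_n], I = (f_1,…,f_r) an ideal of height c, S = R[u_{ij} : 1 ≤ i ≤ c, 1 ≤ j ≤ r], g_i := u_{i1}f_1 + ⋯ + u_{ir}f_r, and L := (g_1,…,g_c) ⊆ S. Let e ≥ 1 and let b ∈ ℕ with b < p^e. If 𝔪 is a maximal ideal of S such that (L^c)^{[b]} ⊆ 𝔪^{[p^e]}, then (I^c)^{[b]} ⊆ 𝔫^{[p^e]}, where 𝔫 := 𝔪 ∩ R. -/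
open Ideal MvPolynomial

set_option synthInstance.maxHeartbeats 1000000
set_option maxHeartbeats 1000000

/-- The Frobenius `q`-th power of an ideal: the ideal generated by `q`-th powers of elements. -/
def Ideal.frobPow {A : Type*} [CommRing A] (q : ℕ) (I : Ideal A) : Ideal A :=
  Ideal.span ((fun h => h ^ q) '' (I : Set A))

/-- The bracket power `I^{[b]}` with respect to the base-`p` expansion of `b`. -/
def Ideal.bracketPow {A : Type*} [CommRing A] (p : ℕ) (I : Ideal A) (b : ℕ) : Ideal A :=
  ∏ i ∈ Finset.range (Nat.digits p b).length,
    Ideal.frobPow (p ^ i) (I ^ ((Nat.digits p b).getD i 0))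

/-- The least critical exponent of an ideal. -/
noncomputable def Ideal.lce {A : Type*} [CommRing A] (p : ℕ) (I : Ideal A) : ℝ :=
  sSup {t : ℝ | ∃ b e : ℕ, t = (b : ℝ) / (p : ℝ) ^ e ∧
    ∀ m : Ideal A, m.IsMaximal → ¬ (I.bracketPow p b ≤ m.frobPow (p ^ e))}

/-- The F-pure threshold of an ideal. -/
noncomputable def Ideal.fpt {A : Type*} [CommRing A] (p : ℕ) (I : Ideal A) : ℝ :=
  sSup {t : ℝ | ∃ a e : ℕ, t = (a : ℝ) / (p : ℝ) ^ e ∧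
    ∀ m : Ideal A, m.IsMaximal → ¬ (I ^ a ≤ m.frobPow (p ^ e))}

/-- The height of an ideal: the infimum of heights of primes containing it. -/
noncomputable def Ideal.idealHeight {A : Type*} [CommRing A] (I : Ideal A) : ℕ∞ :=
  ⨅ p : {p : PrimeSpectrum A // I ≤ p.asIdeal}, Order.height p.1


namespace Ideal

variable {A : Type*} [CommRing A] {p : ℕ}

theorem bracketPow_zero (J : Ideal A) : J.bracketPow p 0 = 1 := by
  simp [bracketPow]

variable [Fact p.Prime] [CharP A p]

theorem frobPow_eq_map_iterateFrobenius (i : ℕ) (J : Ideal A) :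
    J.frobPow (p ^ i) = J.map (iterateFrobenius A p i) :=
  rfl

/-- Splitting off the lowest base-`p` digit of the exponent of a bracket power. -/
theorem bracketPow_eq_mul_map_frobenius (J : Ideal A) {b : ℕ} (hb : 0 < b) :
    J.bracketPow p b = J ^ (b % p) * (J.bracketPow p (b / p)).map (frobenius A p) := by
  have hp : 1 < p := (Fact.out : p.Prime).one_lt
  have map_frobPow (i : ℕ) (K : Ideal A) :
      K.frobPow (p ^ (i + 1)) = (K.frobPow (p ^ i)).map (frobenius A p) := by
    rw [frobPow_eq_map_iterateFrobenius, frobPow_eq_map_iterateFrobenius, map_map]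
    congr 1
    ext x
    simp [iterateFrobenius_def, frobenius_def, pow_succ, pow_mul]
  have map_frobenius_prod (s : Finset ℕ) (K : ℕ → Ideal A) :
      (∏ i ∈ s, K i).map (frobenius A p) = ∏ i ∈ s, (K i).map (frobenius A p) :=
    map_prod (mapHom (frobenius A p)) K s
  have frobPow_zero (K : Ideal A) : K.frobPow (p ^ 0) = K := by
    simp [frobPow]
  rw [bracketPow, Nat.digits_def' hp hb, List.length_cons, Finset.prod_range_succ', mul_comm,
    frobPow_zero, bracketPow, map_frobenius_prod]
  simp [map_frobPow]

theorem pow_mem_bracketPow {J : Ideal A} {x : A} (hx : x ∈ J) (b : ℕ) :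
    x ^ b ∈ J.bracketPow p b := by
  induction b using Nat.strong_induction_on with
  | _ b ih =>
    rcases Nat.eq_zero_or_pos b with rfl | hb
    · simp [bracketPow_zero]
    · rw [bracketPow_eq_mul_map_frobenius J hb]
      have h := mem_map_of_mem (frobenius A p)
        (ih (b / p) (Nat.div_lt_self hb (Fact.out : p.Prime).one_lt))
      have hsplit : x ^ b = x ^ (b % p) * frobenius A p (x ^ (b / p)) := by
        rw [frobenius_def, ← pow_mul, ← pow_add, Nat.mod_add_div']
      rw [hsplit]
      exact mul_mem_mul (pow_mem_pow hx _) h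

end Ideal

namespace MvPolynomial

variable {σ A : Type*} [CommRing A]

/-- The ideal generated by the coefficients of a polynomial. -/
def coeffIdeal (F : MvPolynomial σ A) : Ideal A :=
  Ideal.span (Set.range fun k => F.coeff k)

theorem coeff_mem_coeffIdeal (F : MvPolynomial σ A) (k : σ →₀ ℕ) : F.coeff k ∈ F.coeffIdeal :=
  Ideal.subset_span ⟨k, rfl⟩

open Classical in
/-- Regarding `A[x]` as a free module over `A[x ^ q]` with basis the monomials whose exponents are
all less than `q`, this is the coordinate at `x ^ K`, with `x ^ q` renamed to `x`. -/
noncomputable def powCoord (q : ℕ) (K : σ →₀ ℕ) : MvPolynomial σ A →ₗ[A] MvPolynomial σ A :=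
  (basisMonomials σ A).constr A fun m =>
    if m.mapRange (· % q) (Nat.zero_mod q) = K then
      monomial (m.mapRange (· / q) (Nat.zero_div q)) 1 else 0

open Classical in
theorem powCoord_monomial (q : ℕ) (K m : σ →₀ ℕ) (a : A) :
    powCoord q K (monomial m a) =
      if m.mapRange (· % q) (Nat.zero_mod q) = K then
        monomial (m.mapRange (· / q) (Nat.zero_div q)) a else 0 := by
  have h1 : monomial m a = a • basisMonomials σ A m := by
    simp [smul_monomial]
  rw [h1, map_smul, powCoord, Module.Basis.constr_basis]
  split_ifs <;> simp [smul_monomial]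

theorem coeff_powCoord {q : ℕ} {K : σ →₀ ℕ} (hK : ∀ i, K i < q) (k : σ →₀ ℕ)
    (F : MvPolynomial σ A) : (powCoord q K F).coeff k = F.coeff (K + q • k) := by
  classical
  induction F using MvPolynomial.induction_on' with
  | add F G hF hG => simp [hF, hG]
  | monomial m a =>
    have key : m = K + q • k ↔ m.mapRange (· % q) (Nat.zero_mod q) = K ∧
        m.mapRange (· / q) (Nat.zero_div q) = k := by
      constructor
      · rintro rfl
        constructor <;> ext i
        · simp [Nat.mod_eq_of_lt (hK i)]
        · have hq : 0 < q := (Nat.zero_le _).trans_lt (hK i)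
          simp [Nat.add_mul_div_left _ _ hq, Nat.div_eq_of_lt (hK i)]
      · rintro ⟨rfl, rfl⟩
        ext i
        simp [Nat.mod_add_div]
    rw [powCoord_monomial, coeff_monomial]
    split_ifs with h1 h2 h2
    · rw [coeff_monomial, if_pos (key.mp h2).2]
    · rw [coeff_monomial, if_neg fun h => h2 (key.mpr ⟨h1, h⟩)]
    · exact absurd (key.mp h2).1 h1
    · simp

theorem powCoord_eq_C {q : ℕ} {K : σ →₀ ℕ} (hK : ∀ i, K i < q) {F : MvPolynomial σ A}
    (hF : ∀ i, F.degreeOf i < q) : powCoord q K F = C (F.coeff K) := by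
  classical
  ext k
  rw [coeff_powCoord hK, coeff_C]
  split_ifs with h
  · simp [← h]
  · obtain ⟨i, hi⟩ : ∃ i, k i ≠ 0 := by
      by_contra! hk
      exact h (Finsupp.ext fun i => (hk i).symm)
    by_contra hne
    have h1 := (monomial_le_degreeOf i (mem_support_iff.mpr hne)).trans_lt (hF i)
    have h2 : q ≤ q * k i := Nat.le_mul_of_pos_right _ (Nat.pos_of_ne_zero hi)
    simp at h1
    omega

variable {p : ℕ} [Fact p.Prime] [CharP A p]

theorem powCoord_mul_pow (e : ℕ) (K : σ →₀ ℕ) (F H : MvPolynomial σ A) :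
    powCoord (p ^ e) K (F * H ^ p ^ e) =
      powCoord (p ^ e) K F * map (iterateFrobenius A p e) H := by
  classical
  induction H using MvPolynomial.induction_on' with
  | add G H hG hH => rw [add_pow_char_pow, mul_add, map_add, hG, hH, map_add, mul_add]
  | monomial k a =>
    induction F using MvPolynomial.induction_on' with
    | add F G hF hG => rw [add_mul, map_add, hF, hG, map_add, add_mul]
    | monomial m b =>
      have hq : 0 < p ^ e := pow_pos (Fact.out : p.Prime).pos e
      have hmod : (m + p ^ e • k).mapRange (· % p ^ e) (Nat.zero_mod _) =
          m.mapRange (· % p ^ e) (Nat.zero_mod _) := by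
        ext i; simp
      have hdiv : (m + p ^ e • k).mapRange (· / p ^ e) (Nat.zero_div _) =
          m.mapRange (· / p ^ e) (Nat.zero_div _) + k := by
        ext i; simp [Nat.add_mul_div_left _ _ hq]
      rw [monomial_pow, monomial_mul, powCoord_monomial, powCoord_monomial, hmod, hdiv,
        map_monomial, iterateFrobenius_def]
      split_ifs <;> simp [monomial_mul]

/-- If all exponents occurring in `F` are less than `p`, then there is no cancellation in the
product `F * G ^ p`. -/
theorem coeffIdeal_mul_map_frobenius_le {F : MvPolynomial σ A} (hF : ∀ i, F.degreeOf i < p)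
    (G : MvPolynomial σ A) :
    F.coeffIdeal * G.coeffIdeal.map (frobenius A p) ≤ (F * G ^ p).coeffIdeal := by
  rw [coeffIdeal, coeffIdeal, Ideal.map_span, Ideal.span_mul_span', Ideal.span_le]
  rintro _ ⟨_, ⟨K, rfl⟩, _, ⟨_, ⟨k, rfl⟩, rfl⟩, rfl⟩
  by_cases hK : ∀ i, K i < p
  · have h := congrArg (coeff k) (powCoord_mul_pow (p := p) 1 K F G)
    simp only [pow_one] at h
    rw [coeff_powCoord hK, powCoord_eq_C hK hF, coeff_C_mul, coeff_map, iterateFrobenius_one] at h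
    simpa only [h, SetLike.mem_coe] using coeff_mem_coeffIdeal (F * G ^ p) (K + p • k)
  · have h0 : F.coeff K = 0 := by
      by_contra hne
      exact hK fun i => (monomial_le_degreeOf i (mem_support_iff.mpr hne)).trans_lt (hF i)
    simp [h0]

theorem eval_powCoord_mem_frobPow {e : ℕ} {M : Ideal (MvPolynomial σ A)} {N : Ideal A} (α : σ → A)
    (hα : ∀ H ∈ M, eval α H ∈ N) (K : σ →₀ ℕ) {F : MvPolynomial σ A}
    (hF : F ∈ M.frobPow (p ^ e)) :
    eval (fun i => α i ^ p ^ e) (powCoord (p ^ e) K F) ∈ N.frobPow (p ^ e) := by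
  suffices ∀ s : MvPolynomial σ A,
      eval (fun i => α i ^ p ^ e) (powCoord (p ^ e) K (s * F)) ∈ N.frobPow (p ^ e) by
    simpa using this 1
  induction hF using Submodule.span_induction with
  | mem _ h =>
    obtain ⟨H, hH, rfl⟩ := h
    intro s
    have heval : eval (fun i => α i ^ p ^ e) (map (iterateFrobenius A p e) H) =
        eval α H ^ p ^ e := by
      rw [eval_map, ← iterateFrobenius_def p e (eval α H), eval, coe_eval₂Hom, eval₂_comp_left]
      rfl
    rw [powCoord_mul_pow, map_mul, heval]
    exact Ideal.mul_mem_left _ _ (Ideal.subset_span ⟨_, hα H hH, rfl⟩)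
  | zero => simp
  | add x y _ _ hx hy =>
    intro s
    rw [mul_add, map_add, map_add]
    exact add_mem (hx s) (hy s)
  | smul a x _ hx =>
    intro s
    rw [smul_eq_mul, ← mul_assoc]
    exact hx (s * a)

/-- A polynomial with exponents less than `p ^ e` lying in the Frobenius power of an ideal `M`
has all its coefficients in the Frobenius power of any ideal containing the values of `M` at
some point. -/
theorem coeffIdeal_le_frobPow {e : ℕ} {M : Ideal (MvPolynomial σ A)} {N : Ideal A} (α : σ → A)
    (hα : ∀ H ∈ M, eval α H ∈ N) {F : MvPolynomial σ A} (hdeg : ∀ i, F.degreeOf i < p ^ e)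
    (hF : F ∈ M.frobPow (p ^ e)) : F.coeffIdeal ≤ N.frobPow (p ^ e) := by
  rw [coeffIdeal, Ideal.span_le]
  rintro _ ⟨K, rfl⟩
  by_cases h0 : F.coeff K = 0
  · simp [h0]
  · have hK : ∀ i, K i < p ^ e := fun i =>
      (monomial_le_degreeOf i (mem_support_iff.mpr h0)).trans_lt (hdeg i)
    simpa [powCoord_eq_C hK hdeg] using eval_powCoord_mem_frobPow α hα K hF

section GenericCombinations

variable {ι κ : Type*} [Fintype ι] [Fintype κ]

/-- The product over `i` of the generic linear combinations `∑ j, x i j * f j`. -/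
noncomputable def prodGeneric (ι : Type*) [Fintype ι] (f : κ → A) : MvPolynomial (ι × κ) A :=
  ∏ i, ∑ j, X (i, j) * C (f j)

theorem degreeOf_prodGeneric_pow_le (f : κ → A) (b : ℕ) (x : ι × κ) :
    (prodGeneric ι f ^ b).degreeOf x ≤ b := by
  classical
  cases subsingleton_or_nontrivial A
  · simp [Subsingleton.elim (prodGeneric ι f ^ b) 0]
  suffices (prodGeneric ι f).degreeOf x ≤ 1 from
    (degreeOf_pow_le _ _ _).trans (by simpa using Nat.mul_le_mul_left b this)
  calc (prodGeneric ι f).degreeOf x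
      ≤ ∑ i, (∑ j, X (i, j) * C (f j)).degreeOf x := degreeOf_prod_le _ _ _
    _ ≤ ∑ i, if x.1 = i then 1 else 0 := by
        refine Finset.sum_le_sum fun i _ => (degreeOf_sum_le _ _ _).trans ?_
        refine Finset.sup_le fun j _ => (degreeOf_mul_le _ _ _).trans ?_
        rw [degreeOf_C, degreeOf_X, add_zero]
        split_ifs with h1 h2 <;> simp_all
    _ = 1 := by simp

theorem prodGeneric_pow_eq_sum [DecidableEq ι] [DecidableEq κ] (f : κ → A) (b : ℕ) :
    prodGeneric ι f ^ b =
      ∑ k ∈ Fintype.piFinset fun _ : ι => Finset.piAntidiag (Finset.univ : Finset κ) b,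
        monomial (Finsupp.equivFunOnFinite.symm fun x : ι × κ => k x.1 x.2)
          (∏ i, ((Nat.multinomial Finset.univ (k i) : A) * ∏ j, f j ^ k i j)) := by
  rw [prodGeneric, ← Finset.prod_pow]
  simp_rw [Finset.sum_pow_eq_sum_piAntidiag]
  rw [Finset.prod_univ_sum]
  refine Finset.sum_congr rfl fun k _ => ?_
  rw [monomial_eq, Finsupp.prod_fintype _ _ (fun _ => pow_zero _), Fintype.prod_prod_type]
  simp_rw [map_prod, map_mul, map_prod, map_pow, map_natCast, mul_pow, Finset.prod_mul_distrib]
  simp only [Finsupp.equivFunOnFinite_symm_apply_apply]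
  ring

theorem coeff_prodGeneric_pow (f : κ → A) (b : ℕ) (k : ι → κ → ℕ) (hk : ∀ i, ∑ j, k i j = b) :
    (prodGeneric ι f ^ b).coeff (Finsupp.equivFunOnFinite.symm fun x : ι × κ => k x.1 x.2) =
      ∏ i, ((Nat.multinomial Finset.univ (k i) : A) * ∏ j, f j ^ k i j) := by
  classical
  rw [prodGeneric_pow_eq_sum, coeff_sum, Finset.sum_eq_single k]
  · rw [coeff_monomial, if_pos rfl]
  · intro k' _ hne
    rw [coeff_monomial, if_neg]
    intro h
    refine hne (funext₂ fun i j => ?_)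
    exact congrFun (Finsupp.equivFunOnFinite.symm.injective h) (i, j)
  · intro h
    simp [Finset.mem_piAntidiag, hk] at h

theorem isUnit_multinomial {k : κ → ℕ} {b : ℕ} (hk : ∑ j, k j = b) (hb : b < p) :
    IsUnit (Nat.multinomial Finset.univ k : A) := by
  have hfact : IsUnit ((b.factorial : ℕ) : A) := by
    rw [CharP.isUnit_natCast_iff (p := p) Fact.out]
    rwa [(Fact.out : p.Prime).dvd_factorial, not_le]
  refine isUnit_of_dvd_unit (Nat.cast_dvd_cast ?_) hfact
  rw [← hk, ← Nat.multinomial_spec]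
  exact dvd_mul_left _ _

theorem span_range_pow_pow_le_coeffIdeal (f : κ → A) {b : ℕ} (hb : b < p) :
    (Ideal.span (Set.range f) ^ Fintype.card ι) ^ b ≤ (prodGeneric ι f ^ b).coeffIdeal := by
  classical
  have hspan : (Ideal.span (Set.range f) ^ Fintype.card ι) ^ b =
      ∏ _i : ι, ∏ _s : Fin b, Ideal.span (Set.range f) := by
    simp [← pow_mul, mul_comm]
  rw [hspan]
  simp_rw [Ideal.prod_span]
  rw [Ideal.span_le]
  intro y hy
  obtain ⟨z, hz, rfl⟩ := (Set.mem_fintype_prod _ _).mp hy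
  choose w hw hwz using fun i => (Set.mem_fintype_prod _ _).mp (hz i)
  choose c hc using hw
  let k : ι → κ → ℕ := fun i j => Fintype.card {s : Fin b // c i s = j}
  have hk (i : ι) : ∑ j, k i j = b := by
    simp only [k]
    rw [← Fintype.card_sigma, Fintype.card_congr (Equiv.sigmaFiberEquiv (c i)), Fintype.card_fin]
  have hprod (i : ι) : z i = ∏ j, f j ^ k i j := by
    have h := Finset.prod_fiberwise' Finset.univ (c i) f
    simp only [hc, hwz] at h
    rw [← h]
    simp [k, Fintype.card_subtype]
  have hmem := coeff_mem_coeffIdeal (prodGeneric ι f ^ b)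
    (Finsupp.equivFunOnFinite.symm fun x : ι × κ => k x.1 x.2)
  rw [coeff_prodGeneric_pow f b k hk, Finset.prod_mul_distrib] at hmem
  have hunit : IsUnit (∏ i, (Nat.multinomial Finset.univ (k i) : A)) :=
    (Submonoid.prod_mem (IsUnit.submonoid A) fun i _ => isUnit_multinomial (hk i) hb)
  simpa only [hprod, SetLike.mem_coe] using (Ideal.unit_mul_mem_iff_mem _ hunit).mp hmem

theorem bracketPow_le_coeffIdeal (f : κ → A) (b : ℕ) :
    (Ideal.span (Set.range f) ^ Fintype.card ι).bracketPow p b ≤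
      (prodGeneric ι f ^ b).coeffIdeal := by
  induction b using Nat.strong_induction_on with
  | _ b ih =>
    have hp : p.Prime := Fact.out
    rcases Nat.eq_zero_or_pos b with rfl | hb
    · simpa [Ideal.bracketPow_zero] using
        span_range_pow_pow_le_coeffIdeal (ι := ι) f hp.pos
    · rw [Ideal.bracketPow_eq_mul_map_frobenius _ hb]
      have hmod := Nat.mod_lt b hp.pos
      refine (Ideal.mul_mono (span_range_pow_pow_le_coeffIdeal (ι := ι) f hmod)
        (Ideal.map_mono (ih (b / p) (Nat.div_lt_self hb hp.one_lt)))).trans ?_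
      refine (coeffIdeal_mul_map_frobenius_le
        (fun i => (degreeOf_prodGeneric_pow_le f _ i).trans_lt hmod) _).trans_eq ?_
      rw [← pow_mul, ← pow_add, Nat.mod_add_div']

end GenericCombinations

/-- Over an algebraically closed field, evaluating the outer variables at the corresponding
coordinates of the closed point of a maximal ideal maps that ideal into its contraction. -/
theorem exists_eval_mem_comap_C {𝕜 σ τ : Type*} [Field 𝕜] [IsAlgClosed 𝕜] [Finite σ] [Finite τ]
    (M : Ideal (MvPolynomial σ (MvPolynomial τ 𝕜))) [M.IsMaximal] :
    ∃ α : σ → MvPolynomial τ 𝕜, ∀ H ∈ M, eval α H ∈ M.comap C := by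
  let _ : Field (MvPolynomial σ (MvPolynomial τ 𝕜) ⧸ M) := Ideal.Quotient.field M
  have : Algebra.FiniteType 𝕜 (MvPolynomial σ (MvPolynomial τ 𝕜)) :=
    Algebra.FiniteType.trans (S := MvPolynomial τ 𝕜) inferInstance inferInstance
  have : Module.Finite 𝕜 (MvPolynomial σ (MvPolynomial τ 𝕜) ⧸ M) :=
    finite_of_finite_type_of_isJacobsonRing _ _
  have hsurj := (IsAlgClosed.algebraMap_bijective_of_isIntegral (k := 𝕜)
    (K := MvPolynomial σ (MvPolynomial τ 𝕜) ⧸ M)).2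
  choose a ha using fun i => hsurj (Ideal.Quotient.mk M (X i))
  refine ⟨fun i => C (a i), fun H hH => ?_⟩
  have hcomp : ((Ideal.Quotient.mk M).comp C).comp (eval fun i => C (a i)) =
      Ideal.Quotient.mk M := by
    refine ringHom_ext (fun r => by simp) fun i => ?_
    simp only [RingHom.comp_apply, eval_X, ← ha]
    rfl
  rw [Ideal.mem_comap, ← Ideal.Quotient.eq_zero_iff_mem]
  exact (RingHom.congr_fun hcomp H).trans (Ideal.Quotient.eq_zero_iff_mem.mpr hH)

end MvPolynomial

/-- **Containment transfer (key step for `lce_R(I^c) = lce_S(L^c)`).**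
If `(L^c)^{[b]} ⊆ 𝔪^{[p^e]}` for a maximal ideal `𝔪` of `S`, then
`(I^c)^{[b]} ⊆ 𝔫^{[p^e]}` where `𝔫 = 𝔪 ∩ R`. -/
theorem bracketPow_le_comap_of_bracketPow_le
    {𝕜 : Type*} [Field 𝕜] [IsAlgClosed 𝕜] {p : ℕ} [Fact p.Prime] [CharP 𝕜 p]
    (n r c : ℕ) (f : Fin r → MvPolynomial (Fin n) 𝕜)
    (I : Ideal (MvPolynomial (Fin n) 𝕜)) (hI : I = Ideal.span (Set.range f))
    (hht : I.idealHeight = (c : ℕ∞))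
    (g : Fin c → MvPolynomial (Fin c × Fin r) (MvPolynomial (Fin n) 𝕜))
    (hg : ∀ i, g i = ∑ j : Fin r, X (i, j) * C (f j))
    (L : Ideal (MvPolynomial (Fin c × Fin r) (MvPolynomial (Fin n) 𝕜)))
    (hL : L = Ideal.span (Set.range g))
    (e b : ℕ) (he : 1 ≤ e) (hb : b < p ^ e)
    (m : Ideal (MvPolynomial (Fin c × Fin r) (MvPolynomial (Fin n) 𝕜))) (hm : m.IsMaximal)
    (hle : (L ^ c).bracketPow p b ≤ m.frobPow (p ^ e)) :
    (I ^ c).bracketPow p b ≤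
      (m.comap (C : MvPolynomial (Fin n) 𝕜 →+* MvPolynomial (Fin c × Fin r) (MvPolynomial (Fin n) 𝕜))).frobPow (p ^ e) := by
  obtain ⟨α, hα⟩ := exists_eval_mem_comap_C m
  have hgen : prodGeneric (Fin c) f = ∏ i, g i := by simp [prodGeneric, hg]
  have hmem : prodGeneric (Fin c) f ∈ L ^ c := by
    have h := Ideal.prod_mem_prod (s := Finset.univ) (I := fun _ : Fin c => L) (x := g)
      fun i _ => hL ▸ Ideal.subset_span ⟨i, rfl⟩
    simpa [hgen] using h
  have hcoeff := bracketPow_le_coeffIdeal (ι := Fin c) (p := p) f b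
  rw [Fintype.card_fin, ← hI] at hcoeff
  exact hcoeff.trans <| coeffIdeal_le_frobPow α hα
    (fun i => (degreeOf_prodGeneric_pow_le f b i).trans_lt hb)
    (hle (Ideal.pow_mem_bracketPow hmem b))
end

section
/- Let 𝕜 be an algebraically closed field of characteristic p > 0, R = 𝕜[x_1,…,x_n], and S = R[u_1,…,u_m] a polynomial ring over R. Then for every ideal 𝔞 of R, lce_S(𝔞S) = lce_R(𝔞). -/
open Ideal MvPolynomial

set_option synthInstance.maxHeartbeats 1000000
set_option maxHeartbeats 1000000

namespace Ideal

variable {A B : Type*} [CommRing A] [CommRing B] (p : ℕ)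

theorem frobPow_eq_map_iterateFrobenius_s11 [ExpChar A p] (e : ℕ) (I : Ideal A) :
    I.frobPow (p ^ e) = I.map (iterateFrobenius A p e) :=
  rfl

theorem frobPow_mono (q : ℕ) {I J : Ideal A} (h : I ≤ J) : I.frobPow q ≤ J.frobPow q :=
  span_mono (Set.image_mono h)

theorem map_frobPow [ExpChar A p] [ExpChar B p] (f : A →+* B) (e : ℕ) (I : Ideal A) :
    (I.frobPow (p ^ e)).map f = (I.map f).frobPow (p ^ e) := by
  simp only [frobPow_eq_map_iterateFrobenius_s11, map_map]
  congr 1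
  ext x
  simp [iterateFrobenius_def]

theorem map_bracketPow [ExpChar A p] [ExpChar B p] (f : A →+* B) (b : ℕ) (I : Ideal A) :
    (I.bracketPow p b).map f = (I.map f).bracketPow p b := by
  simp only [bracketPow, ← mapHom_apply, map_prod]
  simp only [mapHom_apply, map_frobPow, Ideal.map_pow]

end Ideal

/-- A maximal ideal of a polynomial ring over a finitely generated algebra over an algebraically
closed field contracts to a maximal ideal, onto which it is mapped by some evaluation of the
variables. -/
theorem MvPolynomial.exists_eval_map_le_comap_C (𝕜 : Type*) {R σ : Type*} [Field 𝕜]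
    [IsAlgClosed 𝕜] [CommRing R] [Algebra 𝕜 R] [Algebra.FiniteType 𝕜 R] [Finite σ]
    (M : Ideal (MvPolynomial σ R)) [M.IsMaximal] :
    (M.comap (C : R →+* MvPolynomial σ R)).IsMaximal ∧
      ∃ c : σ → R, M.map (eval c) ≤ M.comap (C : R →+* MvPolynomial σ R) := by
  let : Field (MvPolynomial σ R ⧸ M) := Ideal.Quotient.field M
  have : Algebra.FiniteType 𝕜 (MvPolynomial σ R) :=
    .trans ‹_› (inferInstance : Algebra.FiniteType R _)
  have : Algebra.FiniteType 𝕜 (MvPolynomial σ R ⧸ M) :=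
    .of_surjective (Ideal.Quotient.mkₐ 𝕜 M) (Ideal.Quotient.mkₐ_surjective 𝕜 M)
  have : Module.Finite 𝕜 (MvPolynomial σ R ⧸ M) := finite_of_finite_type_of_isJacobsonRing 𝕜 _
  have hsurj : Function.Surjective ((Ideal.Quotient.mk M).comp C) := fun y ↦ by
    obtain ⟨a, rfl⟩ := (IsAlgClosed.algebraMap_bijective_of_isIntegral (k := 𝕜)).2 y
    exact ⟨algebraMap 𝕜 R a, rfl⟩
  refine ⟨?_, ?_⟩
  · have h := Ideal.comap_isMaximal_of_surjective _ hsurj (K := ⊥)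
    rwa [← Ideal.comap_comap, ← RingHom.ker_eq_comap_bot, Ideal.mk_ker] at h
  · choose c hc using fun i ↦ hsurj (Ideal.Quotient.mk M (X i))
    have h : ((Ideal.Quotient.mk M).comp C).comp (eval c) = Ideal.Quotient.mk M :=
      MvPolynomial.ringHom_ext (by simp) (by simpa using hc)
    refine ⟨c, Ideal.map_le_iff_le_comap.2 fun f hf ↦ ?_⟩
    rw [Ideal.mem_comap, Ideal.mem_comap, ← Ideal.Quotient.eq_zero_iff_mem]
    exact (RingHom.congr_fun h f).trans (Ideal.Quotient.eq_zero_iff_mem.2 hf)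

/-- **`lce` is unchanged under extension to a polynomial ring.**
For `R = 𝕜[x_1,…,x_n]` and `S = R[u_1,…,u_m]` over an algebraically closed field `𝕜` of
characteristic `p > 0`, `lce_S(𝔞S) = lce_R(𝔞)` for every ideal `𝔞` of `R`. -/
theorem lce_map_C
    {𝕜 : Type*} [Field 𝕜] [IsAlgClosed 𝕜] {p : ℕ} [Fact p.Prime] [CharP 𝕜 p]
    (n m : ℕ) (𝔞 : Ideal (MvPolynomial (Fin n) 𝕜)) :
    Ideal.lce p (𝔞.map (C : MvPolynomial (Fin n) 𝕜 →+*
        MvPolynomial (Fin m) (MvPolynomial (Fin n) 𝕜))) = Ideal.lce p 𝔞 := by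
  have : ExpChar (MvPolynomial (Fin n) 𝕜) p := .prime Fact.out
  have : ExpChar (MvPolynomial (Fin m) (MvPolynomial (Fin n) 𝕜)) p := .prime Fact.out
  have heval (c : Fin m → MvPolynomial (Fin n) 𝕜) : (eval c).comp C = RingHom.id _ := by
    ext <;> simp
  unfold Ideal.lce
  congr 1
  ext t
  refine exists₂_congr fun b e ↦ and_congr_right fun _ ↦ ?_
  rw [← Ideal.map_bracketPow]
  refine ⟨fun h 𝔪 h𝔪 hle ↦ ?_, fun h M hM hle ↦ ?_⟩
  · refine h (𝔪.comap (eval 0))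
      (Ideal.comap_isMaximal_of_surjective _ fun r ↦ ⟨C r, eval_C r⟩) ?_
    refine (Ideal.map_mono hle).trans ?_
    rw [Ideal.map_frobPow]
    refine Ideal.frobPow_mono _ (Ideal.map_le_iff_le_comap.2 ?_)
    rw [Ideal.comap_comap, heval, Ideal.comap_id]
  · obtain ⟨hmax, c, hc⟩ := exists_eval_map_le_comap_C 𝕜 M
    refine h _ hmax ?_
    have h' := Ideal.map_mono (f := eval c) hle
    rw [Ideal.map_map, heval, Ideal.map_id, Ideal.map_frobPow] at h'
    exact h'.trans (Ideal.frobPow_mono _ hc)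
end

section
/- Let 𝕜 be an algebraically closed field of characteristic p > 0, R = 𝕜[x_1,…,x_n], I = (f_1,…,f_r) an ideal of height c, S = R[u_{ij} : 1 ≤ i ≤ c, 1 ≤ j ≤ r], g_i := u_{i1}f_1 + ⋯ + u_{ir}f_r, and L := (g_1,…,g_c) ⊆ S. Then fpt_S(L) ≤ fpt_R(I). -/
open Ideal MvPolynomial

set_option synthInstance.maxHeartbeats 1000000
set_option maxHeartbeats 1000000

theorem Ideal.frobPow_mono_s13 {A : Type*} [CommRing A] (q : ℕ) {I J : Ideal A} (h : I ≤ J) :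
    I.frobPow q ≤ J.frobPow q :=
  Ideal.span_mono (Set.image_mono h)

/-- A sufficiently large ordinary power of a finitely generated ideal lies in its Frobenius power,
with an exponent linear in `q`. -/
theorem Ideal.exists_pow_mul_le_frobPow {A : Type*} [CommRing A] {I : Ideal A} (hI : I.FG) :
    ∃ N : ℕ, ∀ q : ℕ, I ^ (N * q) ≤ I.frobPow q := by
  refine Submodule.fg_induction
    (motive := fun (I : Ideal A) _ => ∃ N : ℕ, ∀ q : ℕ, I ^ (N * q) ≤ I.frobPow q) ?_ ?_ I hI
  · intro x
    refine ⟨1, fun q => ?_⟩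
    rw [one_mul, Ideal.submodule_span_eq, Ideal.span_singleton_pow, Ideal.span_singleton_le_iff_mem]
    exact Ideal.subset_span ⟨x, Ideal.mem_span_singleton_self x, rfl⟩
  · rintro J K - - ⟨N₁, h₁⟩ ⟨N₂, h₂⟩
    refine ⟨N₁ + N₂, fun q => ?_⟩
    rw [add_mul]
    exact Ideal.sup_pow_add_le_pow_sup_pow.trans (sup_le
      ((h₁ q).trans (Ideal.frobPow_mono_s13 q le_sup_left))
      ((h₂ q).trans (Ideal.frobPow_mono_s13 q le_sup_right)))

theorem Ideal.map_frobPow_le {A B : Type*} [CommRing A] [CommRing B] (φ : A →+* B) (q : ℕ)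
    {I : Ideal A} {J : Ideal B} (h : I.map φ ≤ J) : (I.frobPow q).map φ ≤ J.frobPow q := by
  rw [Ideal.frobPow, Ideal.map_span, Ideal.span_le]
  rintro _ ⟨_, ⟨x, hx, rfl⟩, rfl⟩
  exact Ideal.subset_span ⟨φ x, h (Ideal.mem_map_of_mem φ hx), (map_pow φ x q).symm⟩

theorem Ideal.bddAbove_fpt {A : Type*} [CommRing A] [IsNoetherianRing A] {p : ℕ} (hp : 0 < p)
    {I : Ideal A} (hI : I ≠ ⊤) :
    BddAbove {t : ℝ | ∃ a e : ℕ, t = (a : ℝ) / (p : ℝ) ^ e ∧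
      ∀ m : Ideal A, m.IsMaximal → ¬ (I ^ a ≤ m.frobPow (p ^ e))} := by
  obtain ⟨m, hm, hIm⟩ := Ideal.exists_le_maximal I hI
  obtain ⟨N, hN⟩ := Ideal.exists_pow_mul_le_frobPow (IsNoetherian.noetherian m)
  refine ⟨N, ?_⟩
  rintro _ ⟨a, e, rfl, h⟩
  rw [div_le_iff₀ (by positivity)]
  by_contra! hlt
  have hle : N * p ^ e ≤ a := by exact_mod_cast hlt.le
  exact h m hm ((Ideal.pow_right_mono hIm a).trans ((Ideal.pow_le_pow_right hle).trans (hN _)))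

theorem MvPolynomial.exists_isMaximal_map_C_le {A σ : Type*} [CommRing A] {m : Ideal A}
    (hm : m ≠ ⊤) : ∃ M : Ideal (MvPolynomial σ A), M.IsMaximal ∧ m.map C ≤ M := by
  refine Ideal.exists_le_maximal _ fun h => hm ?_
  have := congrArg (Ideal.map (constantCoeff (R := A) (σ := σ))) h
  rwa [Ideal.map_map, constantCoeff_comp_C, Ideal.map_id, Ideal.map_top] at this

/-- **F-pure threshold of the generic link ideal `L`.**
In the generic linkage setup, `fpt_S(L) ≤ fpt_R(I)`. -/
theorem fpt_L_le_fpt_I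
    {𝕜 : Type*} [Field 𝕜] [IsAlgClosed 𝕜] {p : ℕ} [Fact p.Prime] [CharP 𝕜 p]
    (n r c : ℕ) (f : Fin r → MvPolynomial (Fin n) 𝕜)
    (I : Ideal (MvPolynomial (Fin n) 𝕜)) (hI : I = Ideal.span (Set.range f))
    (hht : I.idealHeight = (c : ℕ∞))
    (g : Fin c → MvPolynomial (Fin c × Fin r) (MvPolynomial (Fin n) 𝕜))
    (hg : ∀ i, g i = ∑ j : Fin r, X (i, j) * C (f j))
    (L : Ideal (MvPolynomial (Fin c × Fin r) (MvPolynomial (Fin n) 𝕜)))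
    (hL : L = Ideal.span (Set.range g))
    : Ideal.fpt p L ≤ Ideal.fpt p I := by
  have hI_ne : I ≠ ⊤ := by
    rintro rfl
    have : IsEmpty {p : PrimeSpectrum (MvPolynomial (Fin n) 𝕜) // ⊤ ≤ p.asIdeal} :=
      ⟨fun P => P.1.isPrime.ne_top (top_le_iff.mp P.2)⟩
    rw [Ideal.idealHeight, iInf_of_empty] at hht
    exact ENat.natCast_ne_top c hht.symm
  have hLI : L ≤ I.map C := by
    rw [hL, Ideal.span_le]
    rintro _ ⟨i, rfl⟩
    rw [hg]
    refine Ideal.sum_mem _ fun j _ => Ideal.mul_mem_left _ _ (Ideal.mem_map_of_mem C ?_)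
    rw [hI]
    exact Ideal.subset_span ⟨j, rfl⟩
  refine Real.sSup_le (fun t ht => ?_) (Real.sSup_nonneg ?_)
  · obtain ⟨a, e, rfl, h⟩ := ht
    refine le_csSup (Ideal.bddAbove_fpt (Fact.out : p.Prime).pos hI_ne)
      ⟨a, e, rfl, fun m hm hle => ?_⟩
    obtain ⟨M, hM, hmM⟩ := exists_isMaximal_map_C_le (σ := Fin c × Fin r) hm.ne_top
    refine h M hM ((Ideal.pow_right_mono hLI a).trans ?_)
    rw [← Ideal.map_pow]
    exact (Ideal.map_mono hle).trans (Ideal.map_frobPow_le C _ hmM)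
  · rintro _ ⟨a, e, rfl, -⟩
    positivity
end
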